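/- Let x > 0 and 1 < a < b < M+1. Then there exist constants C₁, C₂ > 0 (depending only on x, a, b, M) such that for all p₁, p₂ ∈ 𝒰(x) ∩ (a, b): C₁·|p₁−p₂|^{1/log a} ≤ ρ(Φ_x(p₁), Φ_x(p₂)) ≤ C₂·|p₁−p₂|^{1/log b}, where logarithms are taken to base M+1. -/

import Mathlib

open scoped ENNReal NNReal Classical

namespace Expansions

/-- Digit sequences over the alphabet `{0,1,…,M}`; index `i : ℕ` represents the
`(i+1)`-st digit `d_{i+1}` of the paper. -/
abbrev Digits (M : ℕ) := ℕ → Fin (M + 1)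

/-- `π_q((d_i)) = Σ_{i≥1} d_i / q^i`. -/
noncomputable def piQ (M : ℕ) (q : ℝ) (d : Digits M) : ℝ :=
  ∑' i : ℕ, (d i : ℝ) / q ^ (i + 1)

/-- `𝒰_q` : the set of real numbers having a unique `q`-expansion. -/
def Uq (M : ℕ) (q : ℝ) : Set ℝ := {x | ∃! d : Digits M, piQ M q d = x}

/-- `𝐔_q` : the set of sequences that are the unique `q`-expansion of their value. -/
def UqSym (M : ℕ) (q : ℝ) : Set (Digits M) :=
  {d | ∀ e : Digits M, piQ M q e = piQ M q d → e = d}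

/-- `𝒰(x)` : the set of univoque bases of `x`. -/
def Ubases (M : ℕ) (x : ℝ) : Set ℝ :=
  {q | q ∈ Set.Ioc (1 : ℝ) ((M : ℝ) + 1) ∧ x ∈ Uq M q}

/-- `q_x = min{M+1, 1+M/x}`. -/
noncomputable def qx (M : ℕ) (x : ℝ) : ℝ := min ((M : ℝ) + 1) (1 + (M : ℝ) / x)

/-- Strict lexicographic order on digit sequences. -/
def lexLt {M : ℕ} (c d : Digits M) : Prop := ∃ n, (∀ i < n, c i = d i) ∧ c n < d n

def lexLe {M : ℕ} (c d : Digits M) : Prop := c = d ∨ lexLt c d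

/-- The sequence ends with `0^∞`. -/
def EndsInZero {M : ℕ} (d : Digits M) : Prop := ∃ N, ∀ n ≥ N, d n = 0

/-- `d` is the quasi-greedy `q`-expansion of `x`: the lexicographically largest
`q`-expansion of `x` not ending with `0^∞`. -/
def IsQuasiGreedy (M : ℕ) (q x : ℝ) (d : Digits M) : Prop :=
  piQ M q d = x ∧ ¬ EndsInZero d ∧
    ∀ e : Digits M, piQ M q e = x → ¬ EndsInZero e → lexLe e d

/-- `Φ_x(q)`: the quasi-greedy `q`-expansion of `x` (junk value if none exists). -/
noncomputable def Phi (M : ℕ) (x q : ℝ) : Digits M :=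
  if h : ∃ d : Digits M, IsQuasiGreedy M q x d then h.choose else fun _ => 0

/-- `𝐔(x) = {Φ_x(q) : q ∈ 𝒰(x)}`. -/
def UxSym (M : ℕ) (x : ℝ) : Set (Digits M) := (Phi M x) '' (Ubases M x)

/-- `ρ((c_i),(d_i)) = (M+1)^{-inf{i ≥ 1 : c_i ≠ d_i}}` (our index `n` represents the
`(n+1)`-st digit, whence the exponent `-(n+1)`); `ρ(c,c) = 0`. -/
noncomputable def rho (M : ℕ) (c d : Digits M) : ℝ :=
  if c = d then 0
  else ((M : ℝ) + 1) ^ (-(((sInf {i | c i ≠ d i} : ℕ) : ℤ) + 1))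

/-- Diameter of a set with respect to a distance function, valued in `ℝ≥0∞`. -/
noncomputable def gdiam {X : Type*} (dist : X → X → ℝ) (A : Set X) : ℝ≥0∞ :=
  ⨆ x ∈ A, ⨆ y ∈ A, ENNReal.ofReal (dist x y)

/-- The `s`-dimensional Hausdorff outer measure with respect to a distance function:
`lim_{δ→0⁺} inf {Σ diam(C n)^s : A ⊆ ⋃ C n, diam (C n) ≤ δ}`. -/
noncomputable def gHMeasure {X : Type*} (dist : X → X → ℝ) (s : ℝ) (A : Set X) : ℝ≥0∞ :=
  ⨆ (δ : ℝ) (_ : 0 < δ),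
    ⨅ (C : ℕ → Set X) (_ : A ⊆ ⋃ n, C n)
      (_ : ∀ n, gdiam dist (C n) ≤ ENNReal.ofReal δ),
      ∑' n, gdiam dist (C n) ^ s

/-- Hausdorff dimension with respect to a distance function. -/
noncomputable def gdimH {X : Type*} (dist : X → X → ℝ) (A : Set X) : ℝ≥0∞ :=
  ⨆ (s : ℝ≥0) (_ : gHMeasure dist (s : ℝ) A = ⊤), (s : ℝ≥0∞)

/-- The generalized golden ratio `q_G`. -/
noncomputable def qG (M : ℕ) : ℝ :=
  if M % 2 = 0 then ((M / 2 : ℕ) : ℝ) + 1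
  else (((M / 2 : ℕ) : ℝ) + 1 +
    Real.sqrt (((M / 2 : ℕ) : ℝ) ^ 2 + 6 * ((M / 2 : ℕ) : ℝ) + 5)) / 2

/-- `x_G = M/(q_G - 1)`. -/
noncomputable def xG (M : ℕ) : ℝ := (M : ℝ) / (qG M - 1)

/-- The Komornik–Loreti constant `q_KL = min 𝒰(1)`. -/
noncomputable def qKL (M : ℕ) : ℝ := sInf (Ubases M 1)

/-- `x_KL = M/(q_KL - 1)`. -/
noncomputable def xKL (M : ℕ) : ℝ := (M : ℝ) / (qKL M - 1)

/-- `X_iso`: the set of `x > 0` such that `𝒰(x)` contains an isolated point. -/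
def Xiso (M : ℕ) : Set ℝ :=
  {x | 0 < x ∧ ∃ q ∈ Ubases M x, ∃ ε > 0, Ubases M x ∩ Set.Ioo (q - ε) (q + ε) = {q}}

/-- The bifurcation set `𝒱 = {q ∈ (1,M+1] : 𝐔_r ≠ 𝐔_q for all r > q}`. -/
def Vset (M : ℕ) : Set ℝ :=
  {q | q ∈ Set.Ioc (1 : ℝ) ((M : ℝ) + 1) ∧
    ∀ r ∈ Set.Ioc (1 : ℝ) ((M : ℝ) + 1), q < r → UqSym M r ≠ UqSym M q}

/-- The Thue–Morse sequence `τ_i` = parity of the binary digit sum of `i`. -/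
def tm (i : ℕ) : ℕ := (Nat.digits 2 i).sum % 2


section Expansion

variable {M : ℕ} {q : ℝ}

/-- The sequence `d` with its first `n` digits removed. -/
def shift (n : ℕ) (d : Digits M) : Digits M := fun i => d (i + n)

lemma digit_le (d : Digits M) (i : ℕ) : (d i : ℕ) ≤ M :=
  Nat.lt_succ_iff.mp (d i).isLt

lemma hasSum_const_div_pow (hq : 1 < q) (c : ℝ) :
    HasSum (fun i : ℕ => c / q ^ (i + 1)) (c / (q - 1)) := by
  have h := (hasSum_geometric_of_lt_one (inv_nonneg.2 (by linarith : (0 : ℝ) ≤ q))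
    (inv_lt_one_of_one_lt₀ hq)).mul_left (c / q)
  have hq0 : q ≠ 0 := by linarith
  have hq1 : q - 1 ≠ 0 := by linarith
  have hterm : (fun i : ℕ => c / q ^ (i + 1)) = fun i => c / q * q⁻¹ ^ i := by
    ext i
    rw [pow_succ, inv_pow]
    field_simp
  have hval : c / (q - 1) = c / q * (1 - q⁻¹)⁻¹ := by
    have : 1 - q⁻¹ = (q - 1) / q := by field_simp
    rw [this]
    field_simp
  rwa [hterm, hval]

lemma digit_div_nonneg (hq : 1 < q) (d : Digits M) (i : ℕ) : 0 ≤ (d i : ℝ) / q ^ (i + 1) := by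
  have : 0 < q := by linarith
  positivity

lemma summable_digits (hq : 1 < q) (d : Digits M) :
    Summable fun i : ℕ => (d i : ℝ) / q ^ (i + 1) := by
  refine (hasSum_const_div_pow hq M).summable.of_nonneg_of_le (digit_div_nonneg hq d) fun i => ?_
  have : 0 < q := by linarith
  gcongr
  exact digit_le d i

lemma piQ_nonneg (hq : 1 < q) (d : Digits M) : 0 ≤ piQ M q d :=
  tsum_nonneg (digit_div_nonneg hq d)

lemma piQ_le (hq : 1 < q) (d : Digits M) : piQ M q d ≤ M / (q - 1) := by
  rw [← (hasSum_const_div_pow hq M).tsum_eq]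
  refine (summable_digits hq d).tsum_le_tsum (fun i => ?_) (hasSum_const_div_pow hq M).summable
  have : 0 < q := by linarith
  gcongr
  exact digit_le d i

lemma piQ_anti {p : ℝ} (hq : 1 < q) (hqp : q ≤ p) (d : Digits M) : piQ M p d ≤ piQ M q d := by
  refine (summable_digits (hq.trans_le hqp) d).tsum_le_tsum (fun i => ?_) (summable_digits hq d)
  have : 0 < q := by linarith
  gcongr

lemma piQ_eq_sum_add (hq : 1 < q) (d : Digits M) (n : ℕ) :
    piQ M q d = ∑ i ∈ Finset.range n, (d i : ℝ) / q ^ (i + 1)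
      + (d n + piQ M q (shift (n + 1) d)) / q ^ (n + 1) := by
  unfold piQ
  rw [← (summable_digits hq d).sum_add_tsum_nat_add (n + 1), Finset.sum_range_succ, add_div,
    ← add_assoc, ← tsum_div_const]
  congr 1
  refine tsum_congr fun i => ?_
  rw [div_div, ← pow_add]
  congr 2
  ring

/-- One step of the greedy algorithm: the digit chosen at remainder `r`. -/
noncomputable def greedyDigit (M : ℕ) (q r : ℝ) : ℕ := min M ⌊q * r⌋₊

/-- The remainders of the greedy algorithm started at `y`. -/
noncomputable def greedyRem (M : ℕ) (q y : ℝ) : ℕ → ℝ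
  | 0 => y
  | n + 1 => q * greedyRem M q y n - greedyDigit M q (greedyRem M q y n)

lemma greedyRem_mem (hq : 1 < q) (hqM : q ≤ M + 1) {y : ℝ} (hy : y ∈ Set.Icc 0 (M / (q - 1)))
    (n : ℕ) : greedyRem M q y n ∈ Set.Icc (0 : ℝ) (M / (q - 1)) := by
  induction n with
  | zero => exact hy
  | succ n ih =>
    obtain ⟨h0, h1⟩ := ih
    have hq1 : 0 < q - 1 := by linarith
    have hqr : 0 ≤ q * greedyRem M q y n := mul_nonneg (by linarith) h0
    rw [le_div_iff₀ hq1] at h1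
    simp only [greedyRem, greedyDigit, Set.mem_Icc, le_div_iff₀ hq1, sub_nonneg]
    have hfl := Nat.floor_le hqr
    have hlt := Nat.lt_floor_add_one (q * greedyRem M q y n)
    refine ⟨le_trans (by exact_mod_cast min_le_right _ _) hfl, ?_⟩
    rcases le_total M ⌊q * greedyRem M q y n⌋₊ with h | h
    · rw [min_eq_left h]
      nlinarith
    · rw [min_eq_right h]
      nlinarith

/-- Every point of `[0, M/(q-1)]` has a `q`-expansion. -/
lemma exists_piQ_eq (hq : 1 < q) (hqM : q ≤ M + 1) {y : ℝ}
    (hy : y ∈ Set.Icc 0 (M / (q - 1))) : ∃ e : Digits M, piQ M q e = y := by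
  let e : Digits M := fun i =>
    ⟨greedyDigit M q (greedyRem M q y i), Nat.lt_succ_of_le (min_le_left _ _)⟩
  have hq0 : 0 < q := by linarith
  have hpart : ∀ n, ∑ i ∈ Finset.range n, (e i : ℝ) / q ^ (i + 1)
      = y - greedyRem M q y n / q ^ n := by
    intro n
    induction n with
    | zero => simp [greedyRem]
    | succ n ih =>
      rw [Finset.sum_range_succ, ih]
      simp only [greedyRem, e]
      field_simp
      ring
  refine ⟨e, tendsto_nhds_unique (summable_digits hq e).hasSum.tendsto_sum_nat ?_⟩
  simp only [hpart]
  have hz : Filter.Tendsto (fun n => greedyRem M q y n / q ^ n) Filter.atTop (nhds 0) := by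
    refine squeeze_zero (fun n => div_nonneg (greedyRem_mem hq hqM hy n).1 (by positivity))
      (fun n => div_le_div_of_nonneg_right (greedyRem_mem hq hqM hy n).2 (by positivity)) ?_
    exact tendsto_const_nhds.div_atTop (tendsto_pow_atTop_atTop_of_one_lt hq)
  simpa using hz.const_sub y

/-- A unique expansion cannot be continued after position `n` with another digit there. -/
lemma not_mem_Icc_of_unique (hq : 1 < q) (hqM : q ≤ M + 1) {d : Digits M} (hd : d ∈ UqSym M q)
    {n : ℕ} {v : Fin (M + 1)} (hv : v ≠ d n) :
    d n + piQ M q (shift (n + 1) d) - v ∉ Set.Icc (0 : ℝ) (M / (q - 1)) := by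
  intro hy
  obtain ⟨e, he⟩ := exists_piQ_eq hq hqM hy
  let f : Digits M := fun i => if i < n then d i else if i = n then v else e (i - (n + 1))
  have hfn : f n = v := by simp [f]
  have hshift : shift (n + 1) f = e := by
    ext i
    have h₁ : ¬ i + (n + 1) < n := by omega
    have h₂ : i + (n + 1) ≠ n := by omega
    simp [shift, f, h₁, h₂]
  have hf : piQ M q f = piQ M q d := by
    rw [piQ_eq_sum_add hq f n, piQ_eq_sum_add hq d n, hshift, he, hfn]
    congr 1
    · refine Finset.sum_congr rfl fun i hi => ?_
      simp [f, Finset.mem_range.1 hi]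
    · congr 1
      ring
  exact hv (by rw [← hfn, hd f hf])

lemma tail_lt_one_of_unique (hq : 1 < q) (hqM : q ≤ M + 1) {d : Digits M} (hd : d ∈ UqSym M q)
    {n : ℕ} {v : Fin (M + 1)} (hv : d n < v) : piQ M q (shift (n + 1) d) < 1 := by
  by_contra! h
  have hlt : (d n : ℕ) + 1 < M + 1 := lt_of_le_of_lt hv v.isLt
  have hw : (⟨d n + 1, hlt⟩ : Fin (M + 1)) ≠ d n := by
    intro hw
    simpa using congrArg Fin.val hw
  refine not_mem_Icc_of_unique hq hqM hd hw ⟨?_, ?_⟩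
  · push_cast
    linarith
  · have := piQ_le hq (shift (n + 1) d)
    push_cast
    linarith

lemma lt_tail_of_unique (hq : 1 < q) (hqM : q ≤ M + 1) {d : Digits M} (hd : d ∈ UqSym M q)
    {n : ℕ} {v : Fin (M + 1)} (hv : v < d n) :
    (M + 1 - q) / (q - 1) < piQ M q (shift (n + 1) d) := by
  by_contra! h
  have hpos : 1 ≤ (d n : ℕ) := Nat.one_le_of_lt hv
  have hlt : (d n : ℕ) - 1 < M + 1 := lt_of_le_of_lt (Nat.sub_le _ _) (d n).isLt
  have hw : (⟨d n - 1, hlt⟩ : Fin (M + 1)) ≠ d n := by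
    intro hw
    have := congrArg Fin.val hw
    simp only at this
    omega
  have hsplit : (M : ℝ) / (q - 1) = (M + 1 - q) / (q - 1) + 1 := by
    have : q - 1 ≠ 0 := by linarith
    field_simp
    ring
  refine not_mem_Icc_of_unique hq hqM hd hw ⟨?_, ?_⟩
  · have := piQ_nonneg hq (shift (n + 1) d)
    push_cast [hpos]
    linarith
  · push_cast [hpos]
    linarith

lemma piQ_eq_zero {d : Digits M} (h : ∀ i, d i = 0) : piQ M q d = 0 := by
  simp [piQ, h]

lemma not_endsInZero_of_unique (hq : 1 < q) (hqM : q ≤ M + 1) {d : Digits M}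
    (hd : d ∈ UqSym M q) (hx : 0 < piQ M q d) : ¬ EndsInZero d := by
  intro hz
  obtain ⟨N, hN, hmin⟩ : ∃ N, (∀ n ≥ N, d n = 0) ∧ ∀ m < N, ¬ ∀ n ≥ m, d n = 0 :=
    ⟨Nat.find hz, Nat.find_spec hz, fun m hm => Nat.find_min hz hm⟩
  cases N with
  | zero => exact hx.ne' (piQ_eq_zero fun i => hN i (Nat.zero_le i))
  | succ n =>
    have hdn : 0 < d n := by
      refine Fin.pos_iff_ne_zero.2 fun h0 => hmin n n.lt_succ_self fun k hk => ?_
      rcases hk.eq_or_lt with rfl | hk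
      · exact h0
      · exact hN k hk
    have h := lt_tail_of_unique hq hqM hd hdn
    rw [piQ_eq_zero (d := shift (n + 1) d) fun i => hN _ (Nat.le_add_left _ _)] at h
    exact h.not_ge (div_nonneg (by linarith) (by linarith))

/-- On univoque bases, `Φ_x(q)` is the unique `q`-expansion of `x`. -/
lemma Phi_spec {x : ℝ} (hx : 0 < x) (h : q ∈ Ubases M x) :
    piQ M q (Phi M x q) = x ∧ Phi M x q ∈ UqSym M q := by
  obtain ⟨⟨hq, hqM⟩, d, hd, huniq⟩ := h
  have hdU : d ∈ UqSym M q := fun e he => huniq e (he.trans hd)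
  have hex : ∃ d, IsQuasiGreedy M q x d :=
    ⟨d, hd, not_endsInZero_of_unique hq hqM hdU (by rwa [hd]), fun e he _ => Or.inl (huniq e he)⟩
  have hPhi : Phi M x q = d := by
    rw [Phi, dif_pos hex]
    exact huniq _ hex.choose_spec.1
  rw [hPhi]
  exact ⟨hd, hdU⟩

end Expansion

section Estimates

variable {M : ℕ}

/-- Strict monotonicity of `q ↦ π_q(c)`, in quantitative form. -/
lemma mul_piQ_le_piQ_sub {p q : ℝ} (hp : 1 < p) (hpq : p ≤ q) (c : Digits M) :
    piQ M p c * (1 - p / q) ≤ piQ M p c - piQ M q c := by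
  have hq : 1 < q := hp.trans_le hpq
  have h : piQ M q c ≤ piQ M p c * (p / q) := by
    unfold piQ
    rw [← tsum_mul_right]
    refine (summable_digits hq c).tsum_le_tsum (fun i => ?_) ((summable_digits hp c).mul_right _)
    have hp0 : 0 < p := by linarith
    have hq0 : 0 < q := by linarith
    calc (c i : ℝ) / q ^ (i + 1) = c i / (q ^ i * q) := by rw [pow_succ]
      _ ≤ c i / (p ^ i * q) := by gcongr
      _ = c i / p ^ (i + 1) * (p / q) := by
        rw [pow_succ]
        field_simp
  linarith

/-- `q ↦ π_q(c)` is Lipschitz on `[a, ∞)`, uniformly in `c`. -/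
lemma exists_piQ_sub_le (M : ℕ) {a : ℝ} (ha : 1 < a) :
    ∃ K > 0, ∀ p q : ℝ, a ≤ p → p ≤ q → ∀ c : Digits M,
      piQ M p c - piQ M q c ≤ K * (q - p) := by
  have ha0 : 0 < a := by linarith
  have hsum : Summable fun i : ℕ => (M : ℝ) * ((i + 1 : ℕ) * (a⁻¹) ^ (i + 1)) := by
    have h := summable_pow_mul_geometric_of_norm_lt_one 1 (r := a⁻¹)
      (by rw [Real.norm_eq_abs, abs_of_pos (by positivity)]; exact inv_lt_one_of_one_lt₀ ha)
    simp only [pow_one] at h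
    exact ((summable_nat_add_iff 1).2 h).mul_left _
  set S := ∑' i : ℕ, (M : ℝ) * ((i + 1 : ℕ) * (a⁻¹) ^ (i + 1)) with hS
  have hS0 : 0 ≤ S := tsum_nonneg fun i => by positivity
  refine ⟨S + 1, by linarith, fun p q hap hpq c => ?_⟩
  have hp : 1 < p := ha.trans_le hap
  have hq : 1 < q := hp.trans_le hpq
  have hp0 : 0 < p := by linarith
  have hq0 : 0 < q := by linarith
  suffices h : piQ M p c - piQ M q c ≤ S * (q - p) by nlinarith
  unfold piQ
  rw [← (summable_digits hp c).tsum_sub (summable_digits hq c), hS, ← tsum_mul_right]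
  refine ((summable_digits hp c).sub (summable_digits hq c)).tsum_le_tsum (fun i => ?_)
    (hsum.mul_right _)
  have hbern : 1 - (p / q) ^ (i + 1) ≤ (i + 1 : ℕ) * (q - p) := by
    have h := one_add_mul_le_pow (a := p / q - 1) (by linarith [div_pos hp0 hq0]) (i + 1)
    rw [add_sub_cancel] at h
    have h' : 1 - p / q ≤ q - p := by
      rw [one_sub_div hq0.ne', div_le_iff₀ hq0]
      nlinarith
    have := mul_le_mul_of_nonneg_left h' (Nat.cast_nonneg (α := ℝ) (i + 1))
    linarith
  have hpa : 1 / p ^ (i + 1) ≤ (a⁻¹) ^ (i + 1) := by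
    rw [inv_pow, one_div]
    gcongr
  calc (c i : ℝ) / p ^ (i + 1) - c i / q ^ (i + 1)
      = c i * (1 / p ^ (i + 1)) * (1 - (p / q) ^ (i + 1)) := by
        rw [div_pow]
        field_simp
    _ ≤ M * (a⁻¹) ^ (i + 1) * ((i + 1 : ℕ) * (q - p)) := by
        have hle : (p / q) ^ (i + 1) ≤ 1 := pow_le_one₀ (by positivity) ((div_le_one hq0).2 hpq)
        gcongr
        exact digit_le c i
    _ = _ := by ring

lemma rho_comm (c d : Digits M) : rho M c d = rho M d c := by
  simp only [rho, eq_comm (a := c), ne_comm (a := c _)]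

lemma exists_first_diff {c d : Digits M} (h : c ≠ d) :
    ∃ n, (∀ i < n, c i = d i) ∧ c n ≠ d n ∧ rho M c d = ((M : ℝ) + 1) ^ (-((n : ℝ) + 1)) := by
  have hne : {i | c i ≠ d i}.Nonempty := Function.ne_iff.1 h
  refine ⟨sInf {i | c i ≠ d i}, fun i hi => ?_, Nat.sInf_mem hne, ?_⟩
  · by_contra hc
    exact Nat.notMem_of_lt_sInf hi hc
  · rw [rho, if_neg h, ← Real.rpow_intCast]
    push_cast
    rfl

lemma rpow_rpow_logb {B t : ℝ} (hB : 1 < B) (ht : 0 < t) (n : ℕ) :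
    (B ^ (-((n : ℝ) + 1))) ^ Real.logb B t = (t ^ (n + 1))⁻¹ := by
  have hB0 : 0 < B := by linarith
  rw [← Real.rpow_mul hB0.le, mul_comm, Real.rpow_mul hB0.le,
    Real.rpow_logb hB0 hB.ne' ht, Real.rpow_neg ht.le, ← Real.rpow_natCast]
  push_cast
  rfl

/-- Upper bound for the distance of two bases in terms of the first differing digit. -/
lemma sub_le_of_first_diff {x a b p q : ℝ} (hx : 0 < x) (ha : 1 < a) (hap : a ≤ p)
    (hpq : p ≤ q) (hqb : q ≤ b) {c d : Digits M} (hc : piQ M p c = x) (hd : piQ M q d = x)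
    {n : ℕ} (hcd : ∀ i < n, c i = d i) :
    q - p ≤ b * (M / (a - 1)) * a / x * (a ^ (n + 1))⁻¹ := by
  have hp : 1 < p := ha.trans_le hap
  have hq : 1 < q := hp.trans_le hpq
  have hq0 : 0 < q := by linarith
  have ha1 : 0 < a - 1 := by linarith
  have h₁ := mul_piQ_le_piQ_sub hp hpq c
  rw [hc, one_sub_div hq0.ne'] at h₁
  have hsplit : ∀ e : Digits M, piQ M q e = ∑ i ∈ Finset.range n, (e i : ℝ) / q ^ (i + 1)
      + piQ M q (shift n e) / q ^ n := by
    intro e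
    unfold piQ
    rw [← (summable_digits hq e).sum_add_tsum_nat_add n, ← tsum_div_const]
    congr 1
    refine tsum_congr fun i => ?_
    rw [div_div, ← pow_add]
    congr 2
    ring
  have hpre : ∑ i ∈ Finset.range n, (c i : ℝ) / q ^ (i + 1)
      = ∑ i ∈ Finset.range n, (d i : ℝ) / q ^ (i + 1) :=
    Finset.sum_congr rfl fun i hi => by rw [hcd i (Finset.mem_range.1 hi)]
  have hdx : x - piQ M q c ≤ M / (a - 1) / a ^ n := by
    rw [← hd, hsplit c, hsplit d, hpre, add_sub_add_left_eq_sub]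
    have hc0 : 0 ≤ piQ M q (shift n c) / q ^ n := div_nonneg (piQ_nonneg hq _) (by positivity)
    calc piQ M q (shift n d) / q ^ n - piQ M q (shift n c) / q ^ n
        ≤ piQ M q (shift n d) / q ^ n := by linarith
      _ ≤ M / (q - 1) / q ^ n := by
        gcongr
        exact piQ_le hq _
      _ ≤ M / (a - 1) / a ^ n := by
        have := hap.trans hpq
        gcongr
  have h₂ : x * (q - p) ≤ M / (a - 1) / a ^ n * b := by
    have h := h₁.trans hdx
    rw [← mul_div_assoc, div_le_iff₀ hq0] at h
    refine h.trans ?_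
    gcongr
  have ha0 : 0 < a := by linarith
  calc q - p = x * (q - p) / x := by field_simp
    _ ≤ M / (a - 1) / a ^ n * b / x := by gcongr
    _ = _ := by
      rw [pow_succ]
      field_simp

/-- Lower bound for the growth of `π_q` past the first differing digit of two unique
expansions of the same number. -/
lemma le_sub_of_first_diff {x b p q : ℝ} (hp : 1 < p) (hpq : p ≤ q) (hqb : q ≤ b)
    (hb : b < M + 1) {c d : Digits M} (hc : piQ M p c = x) (hd : piQ M q d = x)
    (hcU : c ∈ UqSym M p) (hdU : d ∈ UqSym M q) {n : ℕ} (hcd : ∀ i < n, c i = d i)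
    (hn : c n ≠ d n) :
    (M + 1 - b) / (b - 1) * (b ^ (n + 1))⁻¹ ≤ piQ M p c - piQ M q c := by
  have hq : 1 < q := hp.trans_le hpq
  have hq0 : 0 < q := by linarith
  have hpre : ∑ i ∈ Finset.range n, (c i : ℝ) / q ^ (i + 1)
      = ∑ i ∈ Finset.range n, (d i : ℝ) / q ^ (i + 1) :=
    Finset.sum_congr rfl fun i hi => by rw [hcd i (Finset.mem_range.1 hi)]
  have hsub : piQ M q d - piQ M q c = ((d n - c n : ℝ) + (piQ M q (shift (n + 1) d)
      - piQ M q (shift (n + 1) c))) / q ^ (n + 1) := by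
    rw [piQ_eq_sum_add hq d n, piQ_eq_sum_add hq c n, hpre]
    ring
  rw [hc, ← hd, hsub]
  rcases lt_or_gt_of_ne hn with hlt | hgt
  · have hstep : (c n : ℝ) + 1 ≤ d n := by exact_mod_cast hlt
    have hct : piQ M q (shift (n + 1) c) < 1 :=
      (piQ_anti hp hpq _).trans_lt
        (tail_lt_one_of_unique hp ((hpq.trans hqb).trans hb.le) hcU hlt)
    have hdt := lt_tail_of_unique hq (hqb.trans hb.le) hdU hlt
    have hq1 : 0 < q - 1 := by linarith
    have hb0 : 0 < b := by linarith
    have hMq : (0 : ℝ) ≤ M + 1 - q := by linarith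
    calc (M + 1 - b) / (b - 1) * (b ^ (n + 1))⁻¹
        ≤ (M + 1 - q) / (q - 1) * (q ^ (n + 1))⁻¹ := by gcongr
      _ = (M + 1 - q) / (q - 1) / q ^ (n + 1) := by rw [div_eq_mul_inv _ (q ^ (n + 1))]
      _ ≤ _ := by
        gcongr
        linarith
  · exfalso
    have hstep : (d n : ℝ) + 1 ≤ c n := by exact_mod_cast hgt
    have hdt := tail_lt_one_of_unique hq (hqb.trans hb.le) hdU hgt
    have hct := piQ_nonneg hq (shift (n + 1) c)
    have hneg : piQ M q d - piQ M q c < 0 := by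
      rw [hsub]
      exact div_neg_of_neg_of_pos (by linarith) (by positivity)
    have := piQ_anti hp hpq c
    linarith

end Estimates

/-- Proposition (bi-Hölder continuity of `Φ_x`): for `x > 0` and `1 < a < b < M+1`
there are constants `C₁, C₂ > 0` such that for all `p₁, p₂ ∈ 𝒰(x) ∩ (a,b)`,
`C₁ |p₁-p₂|^{1/log a} ≤ ρ(Φ_x(p₁), Φ_x(p₂)) ≤ C₂ |p₁-p₂|^{1/log b}`,
with logarithms taken to base `M+1`. -/
theorem Phi_biHolder (M : ℕ) (hM : 0 < M) (x : ℝ) (hx : 0 < x) (a b : ℝ)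
    (ha : 1 < a) (hab : a < b) (hb : b < (M : ℝ) + 1) :
    ∃ C₁ > (0 : ℝ), ∃ C₂ > (0 : ℝ),
      ∀ p₁ ∈ Ubases M x ∩ Set.Ioo a b, ∀ p₂ ∈ Ubases M x ∩ Set.Ioo a b,
        C₁ * |p₁ - p₂| ^ (1 / Real.logb ((M : ℝ) + 1) a) ≤ rho M (Phi M x p₁) (Phi M x p₂) ∧
        rho M (Phi M x p₁) (Phi M x p₂) ≤ C₂ * |p₁ - p₂| ^ (1 / Real.logb ((M : ℝ) + 1) b) := by
  have hb1 : 1 < b := ha.trans hab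
  have hMpos : (0 : ℝ) < M := by exact_mod_cast hM
  have hB : 1 < (M : ℝ) + 1 := by linarith
  have ha0 : 0 < a := by linarith
  have hb0 : 0 < b := by linarith
  have ha1 : 0 < a - 1 := by linarith
  have hLa : 0 < Real.logb ((M : ℝ) + 1) a := Real.logb_pos hB ha
  have hLb : 0 < Real.logb ((M : ℝ) + 1) b := Real.logb_pos hB hb1
  set La := Real.logb ((M : ℝ) + 1) a with hLa_def
  set Lb := Real.logb ((M : ℝ) + 1) b with hLb_def
  obtain ⟨K, hK, hLip⟩ := exists_piQ_sub_le M ha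
  set A : ℝ := b * (M / (a - 1)) * a / x with hA_def
  have hA : 0 < A := by positivity
  set D : ℝ := (M + 1 - b) / (b - 1) with hD_def
  have hD : 0 < D := div_pos (by linarith) (by linarith)
  have key : ∀ p ∈ Ubases M x ∩ Set.Ioo a b, ∀ q ∈ Ubases M x ∩ Set.Ioo a b, p < q →
      (A ^ (1 / La))⁻¹ * (q - p) ^ (1 / La) ≤ rho M (Phi M x p) (Phi M x q) ∧
      rho M (Phi M x p) (Phi M x q) ≤ (K / D) ^ (1 / Lb) * (q - p) ^ (1 / Lb) := by
    rintro p ⟨hpU, hap, hpb⟩ q ⟨hqU, haq, hqb⟩ hpq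
    obtain ⟨hc, hcU⟩ := Phi_spec hx hpU
    obtain ⟨hd, hdU⟩ := Phi_spec hx hqU
    have hp1 : 1 < p := ha.trans hap
    have hsub : 0 < q - p := by linarith
    have hne : Phi M x p ≠ Phi M x q := by
      intro heq
      have h := mul_piQ_le_piQ_sub hp1 hpq.le (Phi M x p)
      rw [hc, heq, hd, sub_self] at h
      have hlt : p / q < 1 := (div_lt_one (by linarith)).2 hpq
      nlinarith
    obtain ⟨n, hcd, hn, hrho⟩ := exists_first_diff hne
    have hrho0 : 0 < rho M (Phi M x p) (Phi M x q) := by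
      rw [hrho]
      positivity
    have hup := sub_le_of_first_diff hx ha hap.le hpq.le hqb.le hc hd hcd
    have hlow := (le_sub_of_first_diff hp1 hpq.le hqb.le hb hc hd hcU hdU hcd hn).trans
      (hLip p q hap.le hpq.le _)
    rw [← rpow_rpow_logb hB ha0, ← hrho, ← hLa_def, ← hA_def] at hup
    rw [← rpow_rpow_logb hB hb0, ← hrho, ← hLb_def, ← hD_def] at hlow
    constructor
    · rw [inv_mul_le_iff₀ (by positivity)]
      calc (q - p) ^ (1 / La)
          ≤ (A * rho M (Phi M x p) (Phi M x q) ^ La) ^ (1 / La) := by gcongr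
        _ = _ := by
          rw [Real.mul_rpow hA.le (by positivity), ← Real.rpow_mul hrho0.le,
            mul_one_div_cancel hLa.ne', Real.rpow_one]
    · rw [← Real.mul_rpow (by positivity) hsub.le]
      calc rho M (Phi M x p) (Phi M x q)
          = (rho M (Phi M x p) (Phi M x q) ^ Lb) ^ (1 / Lb) := by
            rw [← Real.rpow_mul hrho0.le, mul_one_div_cancel hLb.ne', Real.rpow_one]
        _ ≤ (K / D * (q - p)) ^ (1 / Lb) := by
            gcongr
            rw [div_mul_eq_mul_div, le_div_iff₀ hD]
            linarith
  refine ⟨(A ^ (1 / La))⁻¹, by positivity, (K / D) ^ (1 / Lb), by positivity, ?_⟩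
  intro p₁ h₁ p₂ h₂
  rcases lt_trichotomy p₁ p₂ with h | rfl | h
  · rw [abs_sub_comm, abs_of_pos (by linarith)]
    exact key p₁ h₁ p₂ h₂ h
  · rw [sub_self, abs_zero, Real.zero_rpow (by positivity), Real.zero_rpow (by positivity)]
    simp [rho]
  · rw [rho_comm, abs_of_pos (by linarith)]
    exact key p₂ h₂ p₁ h₁ h

end Expansions
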